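/- Let X and Y be finite-dimensional real Hilbert spaces and let F : X → Y be a C¹ mapping such that (i) the derivative F′(x) is an invertible linear map at every point x ∈ X, and (ii) the functional x ↦ ‖F(x)‖_Y is coercive (i.e. ‖F(x)‖_Y → ∞ as ‖x‖_X → ∞). Then F is a diffeomorphism, i.e. F is bijective and both F and F⁻¹ are C¹. -/

import Mathlib

/-- A proper local homeomorphism from a Hausdorff space to a T₁ space is a covering map. -/
theorem IsProperMap.isCoveringMap_of_isLocalHomeomorph {E B : Type*} [TopologicalSpace E]
    [TopologicalSpace B] [T2Space E] [T1Space B] {f : E → B} (hf : IsProperMap f)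
    (hloc : IsLocalHomeomorph f) : IsCoveringMap f := by
  refine isCoveringMap_iff_isCoveringMapOn_univ.2 <|
    hf.isClosedMap.isCoveringMapOn_of_isLocalHomeomorphOn (fun x _ => ?_) hloc.isLocalHomeomorphOn
  refine (hf.isCompact_preimage isCompact_singleton).finite ?_
  refine .of_openPartialHomeomorph f subset_rfl fun e _ => ?_
  obtain ⟨φ, hφ, h⟩ := hloc e
  exact ⟨φ, hφ, h.symm⟩

/-- A covering map from a nonempty connected space to a simply connected, locally path-connected
space is bijective. -/
theorem IsCoveringMap.bijective_of_simplyConnectedSpace {E B : Type*} [TopologicalSpace E]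
    [TopologicalSpace B] [ConnectedSpace E] [SimplyConnectedSpace B] [LocallyPathConnectedSpace B]
    {f : E → B} (hf : IsCoveringMap f) : Function.Bijective f := by
  obtain ⟨e₀⟩ : Nonempty E := inferInstance
  obtain ⟨g, ⟨hg₀, hg⟩, -⟩ :=
    hf.existsUnique_continuousMap_lifts (ContinuousMap.id B) (f e₀) e₀ rfl
  have hfg : ∀ b, f (g b) = b := fun b => congrFun hg b
  have hgf : g ∘ f = id :=
    hf.eq_of_comp_eq (g.continuous.comp hf.continuous) continuous_id
      (funext fun e => hfg (f e)) e₀ hg₀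
  exact ⟨Function.LeftInverse.injective (congrFun hgf), Function.RightInverse.surjective hfg⟩

/-- **Hadamard's global diffeomorphism theorem** (finite dimensions).
If `X`, `Y` are finite-dimensional real Hilbert spaces and `F : X → Y` is a `C¹`
mapping whose derivative `F′(x)` is invertible at every point, and such that
`x ↦ ‖F x‖` is coercive (`‖F x‖ → ∞` as `‖x‖ → ∞`), then `F` is a diffeomorphism:
it is bijective and possesses a `C¹` (two-sided) inverse. -/
theorem hadamard_global_diffeomorphism
    {X Y : Type*} [NormedAddCommGroup X] [InnerProductSpace ℝ X] [FiniteDimensional ℝ X]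
    [NormedAddCommGroup Y] [InnerProductSpace ℝ Y] [FiniteDimensional ℝ Y]
    (F : X → Y) (hF : ContDiff ℝ 1 F)
    (hinv : ∀ x : X, Function.Bijective (fderiv ℝ F x))
    (hcoercive : Filter.Tendsto (fun x : X => ‖F x‖)
      (Filter.comap (fun x : X => ‖x‖) Filter.atTop) Filter.atTop) :
    Function.Bijective F ∧
      ∃ G : Y → X, Function.LeftInverse G F ∧ Function.RightInverse G F ∧ ContDiff ℝ 1 G := by
  have hderiv : ∀ x, ∃ e : X ≃L[ℝ] Y, HasFDerivAt F (e : X →L[ℝ] Y) x := fun x =>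
    ⟨.ofBijective (fderiv ℝ F x) (LinearMap.ker_eq_bot.2 (hinv x).1)
      (LinearMap.range_eq_top.2 (hinv x).2),
      (hF.differentiable one_ne_zero x).hasFDerivAt⟩
  choose F' hF' using hderiv
  have hloc : IsLocalHomeomorph F := fun x =>
    ⟨hF.contDiffAt.toOpenPartialHomeomorph F (hF' x) one_ne_zero,
      hF.contDiffAt.mem_toOpenPartialHomeomorph_source (hF' x) one_ne_zero, rfl⟩
  have hproper : IsProperMap F := by
    refine isProperMap_iff_tendsto_cocompact.2 ⟨hF.continuous, ?_⟩
    rw [← Metric.cobounded_eq_cocompact, ← Metric.cobounded_eq_cocompact,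
      ← tendsto_norm_atTop_iff_cobounded, ← comap_norm_atTop]
    exact hcoercive
  have hbij : Function.Bijective F :=
    (hproper.isCoveringMap_of_isLocalHomeomorph hloc).bijective_of_simplyConnectedSpace
  let e : X ≃ₜ Y := (Equiv.ofBijective F hbij).toHomeomorphOfContinuousOpen
    hF.continuous hloc.isOpenMap
  exact ⟨hbij, e.symm, e.symm_apply_apply, e.apply_symm_apply, e.contDiff_symm hF' hF⟩
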